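/- Let C be a coalgebra and V a semisimple C-comodule. The following are equivalent: (1) F_V has a greatest element; (2) every totally ordered subset of F_V has an upper bound in F_V; (3) F_V has a maximal element; (4) there exists X ∈ F_V such that whenever X is a subcomodule of a comodule W, then W ≅ X ⊕ X' for some subcomodule X'. Moreover, if for every semisimple comodule X an element I_X ∈ F_X satisfying (4) is chosen, then every C-comodule W embeds into I_{σ(W)}, and conversely this embedding property implies (1) for every semisimple V. -/

import Mathlib

open TensorProduct

namespace SuperCoalg

variable (k : Type) [Field k]
variable (C : Type) [AddCommGroup C] [Module k C] [Coalgebra k C]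

structure IsComodule {V : Type} [AddCommGroup V] [Module k V]
    (β : V →ₗ[k] V ⊗[k] C) : Prop where
  coassoc : (TensorProduct.assoc k V C C).toLinearMap ∘ₗ β.rTensor C ∘ₗ β
      = LinearMap.lTensor V (Coalgebra.comul (R := k) (A := C)) ∘ₗ β
  counit_id : (TensorProduct.rid k V).toLinearMap ∘ₗ
      LinearMap.lTensor V (Coalgebra.counit (R := k) (A := C)) ∘ₗ β = LinearMap.id

/-- A bundled right `C`-comodule. -/
structure Comod where
  V : Type
  [addCommGroup : AddCommGroup V]
  [module : Module k V]
  β : V →ₗ[k] V ⊗[k] C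
  isComodule : IsComodule k C β

attribute [instance] Comod.addCommGroup Comod.module

variable {k C}

def IsSubcomodule {V : Type} [AddCommGroup V] [Module k V]
    (β : V →ₗ[k] V ⊗[k] C) (W : Submodule k V) : Prop :=
  ∀ w ∈ W, β w ∈ LinearMap.range (W.subtype.rTensor C)

def IsComodHom {V W : Type} [AddCommGroup V] [Module k V] [AddCommGroup W] [Module k W]
    (β : V →ₗ[k] V ⊗[k] C) (γ : W →ₗ[k] W ⊗[k] C) (f : V →ₗ[k] W) : Prop :=
  f.rTensor C ∘ₗ β = γ ∘ₗ f

def IsSimpleSubcomodule {V : Type} [AddCommGroup V] [Module k V]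
    (β : V →ₗ[k] V ⊗[k] C) (W : Submodule k V) : Prop :=
  IsSubcomodule β W ∧ W ≠ ⊥ ∧
    ∀ U : Submodule k V, U ≤ W → IsSubcomodule β U → U = ⊥ ∨ U = W

def socle {V : Type} [AddCommGroup V] [Module k V]
    (β : V →ₗ[k] V ⊗[k] C) : Submodule k V :=
  sSup {W : Submodule k V | IsSimpleSubcomodule β W}

/-- A comodule is semisimple if it is the sum of its simple subcomodules. -/
def IsSemisimpleComod (M : Comod k C) : Prop := socle M.β = ⊤

/-- An element of the family `F_V`: a comodule together with an embedding of the
semisimple comodule `V` onto its socle. -/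
structure SocleExt (V : Comod k C) where
  M : Comod k C
  emb : V.V →ₗ[k] M.V
  hom : IsComodHom V.β M.β emb
  inj : Function.Injective emb
  socle_eq : LinearMap.range emb = socle M.β

/-- The (pre)ordering of `F_V` by inclusions. -/
def SocleExt.le {V : Comod k C} (X Y : SocleExt V) : Prop :=
  ∃ f : X.M.V →ₗ[k] Y.M.V,
    IsComodHom X.M.β Y.M.β f ∧ Function.Injective f ∧ f ∘ₗ X.emb = Y.emb

/-- `X ∈ F_V` is an injective object: it splits off every comodule containing it. -/
def SocleExt.IsInj {V : Comod k C} (X : SocleExt V) : Prop :=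
  ∀ (W : Comod k C) (g : X.M.V →ₗ[k] W.V),
    IsComodHom X.M.β W.β g → Function.Injective g →
      ∃ X' : Submodule k W.V, IsSubcomodule W.β X' ∧ IsCompl (LinearMap.range g) X'



section helpers

variable {M N : Type} [AddCommGroup M] [Module k M] [AddCommGroup N] [Module k N]

noncomputable def slice (f : C →ₗ[k] k) : M ⊗[k] C →ₗ[k] M :=
  (TensorProduct.rid k M).toLinearMap ∘ₗ LinearMap.lTensor M f

lemma slice_tmul (f : C →ₗ[k] k) (m : M) (c : C) : slice f (m ⊗ₜ[k] c) = f c • m := by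
  simp [slice]

lemma slice_ext {x y : M ⊗[k] C} (h : ∀ f : C →ₗ[k] k, slice f x = slice f y) : x = y := by
  classical
  apply (TensorProduct.equivFinsuppOfBasisRight (M := M) (Module.Basis.ofVectorSpace k C)).injective
  ext i
  rw [TensorProduct.equivFinsuppOfBasisRight_apply, TensorProduct.equivFinsuppOfBasisRight_apply]
  exact h _

lemma slice_rTensor (f : C →ₗ[k] k) (g : M →ₗ[k] N) (x : M ⊗[k] C) :
    slice f (g.rTensor C x) = g (slice f x) := by
  induction x with
  | zero => simp
  | tmul m c => simp [slice_tmul]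
  | add x y hx hy => simp [hx, hy]

lemma mem_range_rTensor_iff (W : Submodule k M) (x : M ⊗[k] C) :
    x ∈ LinearMap.range (W.subtype.rTensor C) ↔ ∀ f : C →ₗ[k] k, slice f x ∈ W := by
  have ex := rTensor_exact C (f := W.subtype) (g := W.mkQ)
    (by intro y; simp) (Submodule.mkQ_surjective W)
  rw [LinearMap.mem_range, ← Set.mem_range, ← ex x]
  constructor
  · intro h f
    have := slice_rTensor f W.mkQ x
    rw [h, map_zero] at this
    simpa using this.symm
  · intro h
    apply slice_ext
    intro f
    rw [slice_rTensor, map_zero]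
    simpa using h f

noncomputable def act (β : M →ₗ[k] M ⊗[k] C) (f : C →ₗ[k] k) : M →ₗ[k] M := slice f ∘ₗ β

lemma isSub_iff (β : M →ₗ[k] M ⊗[k] C) (W : Submodule k M) :
    IsSubcomodule β W ↔ ∀ f, ∀ w ∈ W, act β f w ∈ W := by
  unfold IsSubcomodule
  simp only [mem_range_rTensor_iff]
  exact ⟨fun h f w hw => h w hw f, fun h w hw f => h f w hw⟩

lemma isHom_iff (β : M →ₗ[k] M ⊗[k] C) (γ : N →ₗ[k] N ⊗[k] C) (g : M →ₗ[k] N) :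
    IsComodHom β γ g ↔ ∀ f v, g (act β f v) = act γ f (g v) := by
  constructor
  · intro h f v
    have := LinearMap.congr_fun h v
    simp only [LinearMap.comp_apply] at this
    simp only [act, LinearMap.comp_apply, ← this, slice_rTensor]
  · intro h
    ext v
    apply slice_ext
    intro f
    simp only [LinearMap.comp_apply, slice_rTensor]
    exact h f v

lemma act_counit {β : M →ₗ[k] M ⊗[k] C} (h : IsComodule k C β) (v : M) :
    act β Coalgebra.counit v = v := LinearMap.congr_fun h.counit_id v

lemma act_act {β : M →ₗ[k] M ⊗[k] C} (h : IsComodule k C β) (f g : C →ₗ[k] k) (v : M) :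
    ∃ e : C →ₗ[k] k, act β f (act β g v) = act β e v := by
  refine ⟨(TensorProduct.lid k k).toLinearMap ∘ₗ TensorProduct.map f g ∘ₗ Coalgebra.comul, ?_⟩
  have h1 := LinearMap.congr_fun h.coassoc v
  simp only [LinearMap.comp_apply, LinearEquiv.coe_coe] at h1
  have h2 : ∀ x : M ⊗[k] C, act β f (slice g x) =
      slice ((TensorProduct.lid k k).toLinearMap ∘ₗ TensorProduct.map f g)
        (TensorProduct.assoc k M C C (β.rTensor C x)) := by
    intro x
    induction x with
    | zero => simp
    | add x y hx hy => simp only [map_add, hx, hy]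
    | tmul m c =>
      simp only [slice_tmul, LinearMap.rTensor_tmul, map_smul, act, LinearMap.comp_apply]
      generalize β m = y
      induction y with
      | zero => simp
      | add x y hx hy => simp only [map_add, hx, hy, smul_add, TensorProduct.add_tmul]
      | tmul m d => simp [slice_tmul, smul_smul, mul_comm]
  change act β f (slice g (β v)) = slice _ (β v)
  rw [h2, h1]
  simp [slice, LinearMap.lTensor_comp]

lemma isSub_inf {β : M →ₗ[k] M ⊗[k] C} {U W : Submodule k M} (hU : IsSubcomodule β U)
    (hW : IsSubcomodule β W) : IsSubcomodule β (U ⊓ W) := by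
  rw [isSub_iff] at *
  exact fun f w hw => ⟨hU f w hw.1, hW f w hw.2⟩

lemma isSub_sSup {β : M →ₗ[k] M ⊗[k] C} {S : Set (Submodule k M)}
    (hS : ∀ U ∈ S, IsSubcomodule β U) : IsSubcomodule β (sSup S) := by
  rw [isSub_iff]
  intro f
  change sSup S ≤ (sSup S).comap (act β f)
  refine sSup_le fun U hU w hw => ?_
  exact (le_sSup hU : U ≤ _) ((isSub_iff β U).1 (hS U hU) f w hw)

lemma isSub_sup {β : M →ₗ[k] M ⊗[k] C} {U W : Submodule k M} (hU : IsSubcomodule β U)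
    (hW : IsSubcomodule β W) : IsSubcomodule β (U ⊔ W) := by
  rw [← sSup_pair]
  apply isSub_sSup
  rintro X (rfl | rfl) <;> assumption

lemma isSub_bot (β : M →ₗ[k] M ⊗[k] C) : IsSubcomodule β ⊥ := by
  rw [isSub_iff]; simp

lemma isSub_top (β : M →ₗ[k] M ⊗[k] C) : IsSubcomodule β ⊤ := by
  rw [isSub_iff]; simp

lemma isSub_map {β : M →ₗ[k] M ⊗[k] C} {γ : N →ₗ[k] N ⊗[k] C} {g : M →ₗ[k] N}
    (hg : IsComodHom β γ g) {U : Submodule k M} (hU : IsSubcomodule β U) :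
    IsSubcomodule γ (U.map g) := by
  rw [isSub_iff] at *
  rw [isHom_iff] at hg
  rintro f _ ⟨w, hw, rfl⟩
  exact ⟨_, hU f w hw, hg f w⟩

lemma isSub_comap {β : M →ₗ[k] M ⊗[k] C} {γ : N →ₗ[k] N ⊗[k] C} {g : M →ₗ[k] N}
    (hg : IsComodHom β γ g) {U : Submodule k N} (hU : IsSubcomodule γ U) :
    IsSubcomodule β (U.comap g) := by
  rw [isSub_iff] at *
  rw [isHom_iff] at hg
  intro f w hw
  rw [Submodule.mem_comap, hg]
  exact hU f _ hw

lemma isHom_comp {P : Type} [AddCommGroup P] [Module k P]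
    {β : M →ₗ[k] M ⊗[k] C} {γ : N →ₗ[k] N ⊗[k] C} {δ : P →ₗ[k] P ⊗[k] C}
    {g : M →ₗ[k] N} {h : N →ₗ[k] P} (hh : IsComodHom γ δ h) (hg : IsComodHom β γ g) :
    IsComodHom β δ (h ∘ₗ g) := by
  rw [isHom_iff] at *
  intro f v
  simp [hg, hh]

/-- every nonzero subcomodule contains a simple one -/
lemma exists_simple {β : M →ₗ[k] M ⊗[k] C} (h : IsComodule k C β) {U : Submodule k M}
    (hU : IsSubcomodule β U) (hne : U ≠ ⊥) : ∃ S ≤ U, IsSimpleSubcomodule β S := by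
  obtain ⟨v, hv, hv0⟩ := U.exists_mem_ne_zero_of_ne_bot hne
  let ev : (C →ₗ[k] k) →ₗ[k] M :=
    { toFun := fun f => act β f v
      map_add' := by intro f g; simp [act, slice, LinearMap.lTensor_add]
      map_smul' := by intro r f; simp [act, slice, LinearMap.lTensor_smul] }
  let D := LinearMap.range ev
  have hfd : FiniteDimensional k D := by
    have key : ∀ x : M ⊗[k] C, ∃ T : Submodule k M, FiniteDimensional k T ∧
        ∀ f : C →ₗ[k] k, slice f x ∈ T := by
      intro x
      induction x with
      | zero => exact ⟨⊥, inferInstance, by simp⟩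
      | tmul m c =>
        exact ⟨Submodule.span k {m}, inferInstance, fun f => by
          rw [slice_tmul]; exact Submodule.smul_mem _ _ (Submodule.mem_span_singleton_self m)⟩
      | add x y hx hy =>
        obtain ⟨A, hA, hA'⟩ := hx
        obtain ⟨B, hB, hB'⟩ := hy
        exact ⟨A ⊔ B, inferInstance, fun f => by
          rw [map_add]; exact Submodule.add_mem_sup (hA' f) (hB' f)⟩
    obtain ⟨T, hT, hT'⟩ := key (β v)
    have : D ≤ T := by
      rintro _ ⟨f, rfl⟩
      exact hT' f
    exact Submodule.finiteDimensional_of_le this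
  have hDsub : IsSubcomodule β D := by
    rw [isSub_iff]
    rintro f _ ⟨g, rfl⟩
    obtain ⟨e, he⟩ := act_act h f g v
    exact ⟨e, he.symm⟩
  have hDU : D ≤ U := by
    rintro _ ⟨f, rfl⟩
    exact (isSub_iff β U).1 hU f v hv
  have hDne : D ≠ ⊥ := by
    intro hb
    have : v ∈ D := ⟨Coalgebra.counit, act_counit h v⟩
    rw [hb] at this
    exact hv0 (by simpa using this)
  let P : Set (Submodule k M) := {T | IsSubcomodule β T ∧ T ≠ ⊥ ∧ T ≤ D}
  have hP : P.Nonempty := ⟨D, hDsub, hDne, le_rfl⟩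
  let S := Function.argminOn (fun T : Submodule k M => Module.finrank k T) P hP
  have hS : S ∈ P := Function.argminOn_mem _ _ _
  refine ⟨S, hS.2.2.trans hDU, hS.1, hS.2.1, ?_⟩
  intro T hT hTs
  by_contra hcon
  push Not at hcon
  have hfS : FiniteDimensional k S := Submodule.finiteDimensional_of_le hS.2.2
  have h1 : Module.finrank k T < Module.finrank k S :=
    Submodule.finrank_lt_finrank_of_lt (lt_of_le_of_ne hT hcon.2)
  exact Function.not_lt_argminOn (fun T : Submodule k M => Module.finrank k T) P
    ⟨hTs, hcon.1, hT.trans hS.2.2⟩ h1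

lemma isComodule_of_inj {β : M →ₗ[k] M ⊗[k] C} {γ : N →ₗ[k] N ⊗[k] C} {g : M →ₗ[k] N}
    (hg : IsComodHom β γ g) (hi : Function.Injective g) (h : IsComodule k C γ) :
    IsComodule k C β := by
  have hgv : ∀ v, g.rTensor C (β v) = γ (g v) := LinearMap.congr_fun hg
  constructor
  · ext v
    have hinj := Module.Flat.rTensor_preserves_injective_linearMap (M := C ⊗[k] C) g hi
    apply hinj
    have h1 := LinearMap.congr_fun h.coassoc (g v)
    simp only [LinearMap.comp_apply, LinearEquiv.coe_coe] at h1 ⊢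
    have e1 : ∀ x : M ⊗[k] C, g.rTensor (C ⊗[k] C) (TensorProduct.assoc k M C C (β.rTensor C x))
        = TensorProduct.assoc k N C C (γ.rTensor C (g.rTensor C x)) := by
      intro x
      have : ∀ y : (M ⊗[k] C) ⊗[k] C, g.rTensor (C ⊗[k] C) (TensorProduct.assoc k M C C y)
          = TensorProduct.assoc k N C C ((g.rTensor C).rTensor C y) := by
        intro y
        have : g.rTensor (C ⊗[k] C) ∘ₗ (TensorProduct.assoc k M C C).toLinearMap
          = (TensorProduct.assoc k N C C).toLinearMap ∘ₗ ((g.rTensor C).rTensor C) := by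
          ext; simp
        exact LinearMap.congr_fun this y
      rw [this]
      congr 1
      rw [← LinearMap.comp_apply, ← LinearMap.comp_apply, ← LinearMap.rTensor_comp,
        ← LinearMap.rTensor_comp, hg]
    have e2 : ∀ x : M ⊗[k] C, g.rTensor (C ⊗[k] C) (LinearMap.lTensor M (Coalgebra.comul (R := k) (A := C)) x)
        = LinearMap.lTensor N (Coalgebra.comul (R := k) (A := C)) (g.rTensor C x) := by
      intro x
      rw [← LinearMap.comp_apply, ← LinearMap.comp_apply, LinearMap.rTensor_comp_lTensor,
        LinearMap.lTensor_comp_rTensor]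
    rw [e1, e2, hgv, h1]
  · ext v
    apply hi
    have h1 := (isHom_iff β γ g).1 hg Coalgebra.counit v
    rw [act_counit h] at h1
    exact h1

/-- Coaction restricted to a subcomodule. -/
lemma exists_sub {γ : M →ₗ[k] M ⊗[k] C} (hγ : IsComodule k C γ) (E : Submodule k M)
    (hE : IsSubcomodule γ E) :
    ∃ β : E →ₗ[k] E ⊗[k] C, IsComodule k C β ∧ IsComodHom β γ E.subtype := by
  obtain ⟨p, hp⟩ := E.subtype.exists_leftInverse_of_injective E.ker_subtype
  have hom : IsComodHom (p.rTensor C ∘ₗ γ ∘ₗ E.subtype) γ E.subtype := by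
    ext w
    obtain ⟨y, hy⟩ := hE w w.2
    simp only [LinearMap.comp_apply, Submodule.subtype_apply, ← hy]
    congr 1
    rw [← LinearMap.comp_apply, ← LinearMap.rTensor_comp, hp]
    simp
  exact ⟨_, isComodule_of_inj hom E.injective_subtype hγ, hom⟩

variable (k C M) in
noncomputable def cofreeβ : M ⊗[k] C →ₗ[k] (M ⊗[k] C) ⊗[k] C :=
  (TensorProduct.assoc k M C C).symm.toLinearMap ∘ₗ LinearMap.lTensor M Coalgebra.comul

lemma cofree_isComodule : IsComodule k C (cofreeβ k C M) := by
  constructor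
  · ext m c
    simp only [TensorProduct.AlgebraTensorModule.curry_apply, TensorProduct.curry_apply,
      LinearMap.coe_restrictScalars, LinearMap.comp_apply, LinearEquiv.coe_coe, cofreeβ,
      LinearMap.lTensor_tmul]
    have h1 := Coalgebra.coassoc_apply (R := k) c
    have e1 : ∀ x : C ⊗[k] C, TensorProduct.assoc k (M ⊗[k] C) C C
        ((cofreeβ k C M).rTensor C ((TensorProduct.assoc k M C C).symm (m ⊗ₜ x)))
        = (TensorProduct.assoc k M C (C ⊗[k] C)).symm (m ⊗ₜ TensorProduct.assoc k C C C
          ((Coalgebra.comul (R := k) (A := C)).rTensor C x)) := by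
      intro x
      induction x with
      | zero => simp
      | add x y hx hy => simp only [map_add, TensorProduct.tmul_add, hx, hy]
      | tmul a b =>
        simp only [TensorProduct.assoc_symm_tmul, LinearMap.rTensor_tmul, cofreeβ,
          LinearMap.comp_apply, LinearMap.lTensor_tmul, LinearEquiv.coe_coe]
        generalize Coalgebra.comul (R := k) a = y
        induction y with
        | zero => simp
        | add x y hx hy => simp only [map_add, TensorProduct.tmul_add, TensorProduct.add_tmul, hx, hy]
        | tmul a b => simp
    have e2 : ∀ x : C ⊗[k] C, LinearMap.lTensor (M ⊗[k] C) (Coalgebra.comul (R := k) (A := C))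
        ((TensorProduct.assoc k M C C).symm (m ⊗ₜ x)) =
        (TensorProduct.assoc k M C (C ⊗[k] C)).symm (m ⊗ₜ
          (Coalgebra.comul (R := k) (A := C)).lTensor C x) := by
      intro x
      induction x with
      | zero => simp
      | add x y hx hy => simp only [map_add, TensorProduct.tmul_add, hx, hy]
      | tmul a b => simp
    rw [e2, ← h1, ← e1]
    rfl
  · ext m c
    simp only [TensorProduct.AlgebraTensorModule.curry_apply, TensorProduct.curry_apply,
      LinearMap.coe_restrictScalars, LinearMap.comp_apply, LinearEquiv.coe_coe, cofreeβ,
      LinearMap.lTensor_tmul, LinearMap.id_apply]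
    have e2 : ∀ x : C ⊗[k] C, TensorProduct.rid k (M ⊗[k] C)
        (LinearMap.lTensor (M ⊗[k] C) (Coalgebra.counit (R := k) (A := C))
        ((TensorProduct.assoc k M C C).symm (m ⊗ₜ x))) =
        (m ⊗ₜ TensorProduct.rid k C ((Coalgebra.counit (R := k) (A := C)).lTensor C x)) := by
      intro x
      induction x with
      | zero => simp
      | add x y hx hy => simp only [map_add, TensorProduct.tmul_add, hx, hy]
      | tmul a b => simp
    rw [e2, Coalgebra.lTensor_counit_comul]
    simp

variable (k C M) in
noncomputable def cofree : Comod k C := ⟨M ⊗[k] C, cofreeβ k C M, cofree_isComodule⟩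

lemma cofree_hom {β : N →ₗ[k] N ⊗[k] C} (h : IsComodule k C β) (l : N →ₗ[k] M) :
    IsComodHom β (cofreeβ k C M) (l.rTensor C ∘ₗ β) := by
  ext v
  have h1 := LinearMap.congr_fun h.coassoc v
  simp only [LinearMap.comp_apply, LinearEquiv.coe_coe, cofreeβ] at h1 ⊢
  rw [← LinearMap.comp_apply (LinearMap.lTensor _ _), LinearMap.lTensor_comp_rTensor,
    ← LinearMap.rTensor_comp_lTensor, LinearMap.comp_apply, ← h1, LinearMap.rTensor_comp,
    LinearMap.comp_apply]
  generalize β.rTensor C (β v) = y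
  have : (l.rTensor C).rTensor C = (TensorProduct.assoc k M C C).symm.toLinearMap ∘ₗ
      l.rTensor (C ⊗[k] C) ∘ₗ (TensorProduct.assoc k N C C).toLinearMap := by
    ext; simp
  rw [this]; rfl

lemma cofree_counit (x : M ⊗[k] C) :
    (slice (M := M) (Coalgebra.counit (R := k) (A := C))).rTensor C (cofreeβ k C M x) = x := by
  induction x with
  | zero => simp
  | add x y hx hy => simp only [map_add, hx, hy]
  | tmul m c =>
    have e : ∀ x : C ⊗[k] C, (slice (M := M) (Coalgebra.counit (R := k) (A := C))).rTensor C
        ((TensorProduct.assoc k M C C).symm (m ⊗ₜ x)) =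
        m ⊗ₜ TensorProduct.lid k C ((Coalgebra.counit (R := k) (A := C)).rTensor C x) := by
      intro x
      induction x with
      | zero => simp
      | add x y hx hy => simp only [map_add, TensorProduct.tmul_add, hx, hy]
      | tmul a b => simp [slice_tmul, TensorProduct.smul_tmul]
    simp only [cofreeβ, LinearMap.comp_apply, LinearMap.lTensor_tmul, LinearEquiv.coe_coe, e,
      Coalgebra.rTensor_counit_comul]
    simp

lemma cofree_extend {P : Type} [AddCommGroup P] [Module k P]
    {β : N →ₗ[k] N ⊗[k] C} {γ : P →ₗ[k] P ⊗[k] C}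
    (hγ : IsComodule k C γ) {g : N →ₗ[k] P} (hg : IsComodHom β γ g) (hi : Function.Injective g)
    {ψ : N →ₗ[k] M ⊗[k] C} (hψ : IsComodHom β (cofreeβ k C M) ψ) :
    ∃ h : P →ₗ[k] M ⊗[k] C, IsComodHom γ (cofreeβ k C M) h ∧ h ∘ₗ g = ψ := by
  obtain ⟨p, hp⟩ := g.exists_leftInverse_of_injective (LinearMap.ker_eq_bot.2 hi)
  refine ⟨_, cofree_hom hγ (slice Coalgebra.counit ∘ₗ ψ ∘ₗ p), ?_⟩
  rw [LinearMap.comp_assoc, ← hg, ← LinearMap.comp_assoc, ← LinearMap.rTensor_comp,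
    LinearMap.comp_assoc, LinearMap.comp_assoc, hp, LinearMap.comp_id, LinearMap.rTensor_comp,
    LinearMap.comp_assoc, hψ]
  ext v
  exact cofree_counit _

end helpers

section hull

variable {M N : Type} [AddCommGroup M] [Module k M] [AddCommGroup N] [Module k N]

lemma isSimple_map {β : M →ₗ[k] M ⊗[k] C} {γ : N →ₗ[k] N ⊗[k] C} {g : M →ₗ[k] N}
    (hg : IsComodHom β γ g) (hi : Function.Injective g) {S : Submodule k M}
    (hS : IsSimpleSubcomodule β S) : IsSimpleSubcomodule γ (S.map g) := by
  refine ⟨isSub_map hg hS.1, ?_, ?_⟩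
  · intro h
    exact hS.2.1 (Submodule.map_injective_of_injective hi (h.trans (Submodule.map_bot g).symm))
  · intro U hU hUs
    have hUr : (U.comap g).map g = U := by
      rw [Submodule.map_comap_eq, inf_eq_right]
      exact hU.trans (LinearMap.map_le_range)
    have h1 : U.comap g ≤ S := by
      intro x hx
      obtain ⟨y, hy, hyx⟩ := hU hx
      rwa [← hi hyx]
    rcases hS.2.2 _ h1 (isSub_comap hg hUs) with h | h
    · left; rw [← hUr, h, Submodule.map_bot]
    · right; rw [← hUr, h]

def Ess (β : M →ₗ[k] M ⊗[k] C) (V E : Submodule k M) : Prop :=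
  ∀ U, IsSubcomodule β U → U ≤ E → Disjoint U V → U = ⊥

lemma exists_max_ess (β : M →ₗ[k] M ⊗[k] C) (V : Submodule k M) (hV : IsSubcomodule β V) :
    ∃ E, IsSubcomodule β E ∧ V ≤ E ∧ Ess β V E ∧
      ∀ F, IsSubcomodule β F → E ≤ F → Ess β V F → F = E := by
  obtain ⟨E, hVE, hE⟩ := zorn_le_nonempty₀ {E | IsSubcomodule β E ∧ Ess β V E} (by
    intro c hc hch y hy
    refine ⟨sSup c, ⟨isSub_sSup fun U hU => (hc hU).1, ?_⟩, fun z hz => le_sSup hz⟩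
    intro U hU hUc hd
    rw [eq_bot_iff]
    intro u hu
    obtain ⟨T, hT, huT⟩ := (Submodule.mem_sSup_of_directed ⟨y, hy⟩ hch.directedOn).1 (hUc hu)
    have := (hc hT).2 (U ⊓ T) (isSub_inf hU (hc hT).1) inf_le_right (hd.mono_left inf_le_left)
    rw [← this]
    exact ⟨hu, huT⟩) V ⟨hV, fun U _ h1 h2 => disjoint_self.1 (h2.mono_right h1)⟩
  exact ⟨E, hE.prop.1, hVE, hE.prop.2, fun F h1 h2 h3 => (hE.eq_of_le ⟨h1, h3⟩ h2).symm⟩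

lemma exists_max_disj (β : M →ₗ[k] M ⊗[k] C) (E : Submodule k M) :
    ∃ K, IsSubcomodule β K ∧ Disjoint K E ∧
      ∀ F, IsSubcomodule β F → K ≤ F → Disjoint F E → F = K := by
  obtain ⟨K, hVE, hK⟩ := zorn_le_nonempty₀ {K | IsSubcomodule β K ∧ Disjoint K E} (by
    intro c hc hch y hy
    refine ⟨sSup c, ⟨isSub_sSup fun U hU => (hc hU).1, ?_⟩, fun z hz => le_sSup hz⟩
    rw [Submodule.disjoint_def]
    intro u hu huE
    obtain ⟨T, hT, huT⟩ := (Submodule.mem_sSup_of_directed ⟨y, hy⟩ hch.directedOn).1 hu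
    exact Submodule.disjoint_def.1 (hc hT).2 u huT huE) ⊥ ⟨isSub_bot β, disjoint_bot_left⟩
  exact ⟨K, hK.prop.1, hK.prop.2, fun F h1 h2 h3 => (hK.eq_of_le ⟨h1, h3⟩ h2).symm⟩

lemma exists_hull (V : Submodule k (M ⊗[k] C)) (hV : IsSubcomodule (cofreeβ k C M) V) :
    ∃ E K, IsSubcomodule (cofreeβ k C M) E ∧ V ≤ E ∧ Ess (cofreeβ k C M) V E ∧
      IsSubcomodule (cofreeβ k C M) K ∧ IsCompl E K := by
  obtain ⟨E, hE, hVE, hess, hmax⟩ := exists_max_ess _ V hV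
  obtain ⟨K, hK, hKE, hKmax⟩ := exists_max_disj (cofreeβ k C M) E
  refine ⟨E, K, hE, hVE, hess, hK, hKE.symm, ?_⟩
  obtain ⟨A, hA1, hA2⟩ := hKE.symm.exists_isCompl
  obtain ⟨δ, hδ, hδhom⟩ := exists_sub (cofree_isComodule (k := k) (C := C) (M := M)) (E ⊔ K) (isSub_sup hE hK)
  let p : M ⊗[k] C →ₗ[k] M ⊗[k] C := A.projection K hA2
  have hpE : ∀ x ∈ E, p x = x := fun x hx => Submodule.projection_apply_left hA2 ⟨x, hA1 hx⟩
  have hpK : ∀ x ∈ K, p x = 0 := fun x hx => Submodule.projection_apply_right hA2 ⟨x, hx⟩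
  have hψ : IsComodHom δ (cofreeβ k C M) (p ∘ₗ (E ⊔ K).subtype) := by
    rw [isHom_iff] at hδhom ⊢
    intro f v
    have h1 := hδhom f v
    simp only [LinearMap.comp_apply]
    rw [h1]
    change p (act (cofreeβ k C M) f (v : M ⊗[k] C)) = act (cofreeβ k C M) f (p (v : M ⊗[k] C))
    obtain ⟨x, hx, y, hy, hxy⟩ := Submodule.mem_sup.1 v.2
    rw [← hxy]
    simp only [map_add]
    rw [hpE _ ((isSub_iff _ E).1 hE f x hx), hpK _ ((isSub_iff _ K).1 hK f y hy), hpE x hx,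
      hpK y hy, map_zero]
  obtain ⟨φ, hφ, hφe⟩ := cofree_extend cofree_isComodule hδhom (E ⊔ K).injective_subtype hψ
  have hφE : ∀ x ∈ E, φ x = x := fun x hx =>
    (LinearMap.congr_fun hφe ⟨x, Submodule.mem_sup_left hx⟩).trans (hpE x hx)
  have hφK : ∀ x ∈ K, φ x = 0 := fun x hx =>
    (LinearMap.congr_fun hφe ⟨x, Submodule.mem_sup_right hx⟩).trans (hpK x hx)
  have pull : ∀ U, IsSubcomodule (cofreeβ k C M) U → Disjoint U E → U.comap φ = K := by
    intro U hU hd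
    apply hKmax _ (isSub_comap hφ hU)
    · intro x hx
      rw [Submodule.mem_comap, hφK x hx]
      exact zero_mem _
    · rw [Submodule.disjoint_def] at hd ⊢
      intro x hx hxE
      rw [Submodule.mem_comap, hφE x hxE] at hx
      exact hd x hx hxE
  have hr : LinearMap.range φ = E := by
    apply hmax
    · rw [LinearMap.range_eq_map]
      exact isSub_map hφ (isSub_top _)
    · intro x hx
      exact ⟨x, hφE x hx⟩
    · intro U hU hUr hd
      have hUE : Disjoint U E := by
        rw [disjoint_iff]
        exact hess _ (isSub_inf hU hE) inf_le_right (hd.mono_left inf_le_left)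
      have := pull U hU hUE
      rw [eq_bot_iff]
      intro u hu
      obtain ⟨x, rfl⟩ := hUr hu
      have hx : x ∈ K := by rw [← this]; exact hu
      simp [hφK x hx]
  have hker : (⊥ : Submodule k (M ⊗[k] C)).comap φ = K := pull ⊥ (isSub_bot _) disjoint_bot_left
  rw [codisjoint_iff, eq_top_iff]
  intro x _
  have h1 : φ x ∈ E := by rw [← hr]; exact ⟨x, rfl⟩
  have h2 : x - φ x ∈ K := by
    rw [← hker, Submodule.mem_comap, map_sub, hφE _ h1, sub_self]
    exact zero_mem _
  have := Submodule.add_mem_sup h1 h2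
  rwa [add_sub_cancel] at this

lemma β_hom {β : M →ₗ[k] M ⊗[k] C} (h : IsComodule k C β) : IsComodHom β (cofreeβ k C M) β := by
  have := cofree_hom h (LinearMap.id : M →ₗ[k] M)
  simpa using this

lemma β_inj {β : M →ₗ[k] M ⊗[k] C} (h : IsComodule k C β) : Function.Injective β := by
  intro x y hxy
  rw [← act_counit h x, ← act_counit h y]
  simp [act, hxy]

lemma split_aux {E K : Submodule k (M ⊗[k] C)} (hK : IsSubcomodule (cofreeβ k C M) K)
    (hc : IsCompl E K) {δ : E →ₗ[k] E ⊗[k] C} (hδhom : IsComodHom δ (cofreeβ k C M) E.subtype)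
    (W : Comod k C) {g : E →ₗ[k] W.V} (hg : IsComodHom δ W.β g) (hgi : Function.Injective g) :
    ∃ X' : Submodule k W.V, IsSubcomodule W.β X' ∧ IsCompl (LinearMap.range g) X' := by
  obtain ⟨h, hh, hhg⟩ := cofree_extend W.isComodule hg hgi hδhom
  have hhg' : ∀ e : E, h (g e) = e := LinearMap.congr_fun hhg
  refine ⟨K.comap h, isSub_comap hh hK, ?_, ?_⟩
  · rw [Submodule.disjoint_def]
    rintro _ ⟨e, rfl⟩ he
    rw [Submodule.mem_comap, hhg'] at he
    have := Submodule.disjoint_def.1 hc.disjoint e e.2 he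
    have he0 : e = 0 := Subtype.ext this
    rw [he0, map_zero]
  · rw [codisjoint_iff, eq_top_iff]
    intro w _
    have : h w ∈ E ⊔ K := by rw [hc.sup_eq_top]; trivial
    obtain ⟨e, he, κ, hκ, heq⟩ := Submodule.mem_sup.1 this
    have h2 : w - g ⟨e, he⟩ ∈ K.comap h := by
      rw [Submodule.mem_comap, map_sub, hhg', ← heq]
      simpa using hκ
    have := Submodule.add_mem_sup (LinearMap.mem_range_self g ⟨e, he⟩) h2
    rwa [add_sub_cancel] at this

lemma exists_isInj (V : Comod k C) (hV : IsSemisimpleComod V) : ∃ X : SocleExt V, X.IsInj := by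
  have hhom := β_hom V.isComodule
  have hVs : IsSubcomodule (cofreeβ k C V.V) (LinearMap.range V.β) := by
    rw [LinearMap.range_eq_map]
    exact isSub_map hhom (isSub_top _)
  obtain ⟨E, K, hE, hVE, hess, hK, hc⟩ := exists_hull _ hVs
  obtain ⟨δ, hδ, hδhom⟩ := exists_sub (cofree_isComodule (k := k) (C := C) (M := V.V)) E hE
  let emb : V.V →ₗ[k] E := V.β.codRestrict E (fun v => hVE ⟨v, rfl⟩)
  have hemb : IsComodHom V.β δ emb := by
    rw [isHom_iff] at hδhom hhom ⊢
    intro f v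
    apply Subtype.ext
    exact (hhom f v).trans (hδhom f (emb v)).symm
  have hinj : Function.Injective emb := by
    intro x y hxy
    exact β_inj V.isComodule (congrArg Subtype.val hxy)
  have hsoc : LinearMap.range emb = socle δ := by
    apply le_antisymm
    · rw [LinearMap.range_eq_map, ← (hV : socle V.β = ⊤), socle, Submodule.map_le_iff_le_comap]
      refine sSup_le fun S hS => ?_
      rw [← Submodule.map_le_iff_le_comap]
      exact le_sSup (isSimple_map hemb hinj hS)
    · refine sSup_le fun S hS => ?_
      have hrs : IsSubcomodule δ (LinearMap.range emb) := by
        rw [LinearMap.range_eq_map]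
        exact isSub_map hemb (isSub_top _)
      rcases hS.2.2 (S ⊓ LinearMap.range emb) inf_le_left (isSub_inf hS.1 hrs) with h | h
      · exfalso
        have h1 := hess (S.map E.subtype) (isSub_map hδhom hS.1) (Submodule.map_subtype_le _ _) (by
          rw [Submodule.disjoint_def]
          rintro _ ⟨x, hx, rfl⟩ ⟨v, hv⟩
          have : x ∈ S ⊓ LinearMap.range emb := ⟨hx, v, Subtype.ext hv⟩
          rw [h] at this
          rw [(Submodule.mem_bot k).1 this, map_zero])
        exact hS.2.1 (Submodule.map_injective_of_injective E.injective_subtype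
          (h1.trans (Submodule.map_bot E.subtype).symm))
      · exact inf_eq_left.1 h
  refine ⟨⟨⟨E, δ, hδ⟩, emb, hemb, hinj, hsoc⟩, ?_⟩
  intro W g hg hgi
  exact split_aux hK hc hδhom W hg hgi

lemma le_of_isInj {V : Comod k C} (I : SocleExt V) (hI : I.IsInj) (X : SocleExt V) : X.le I := by
  have hhom := β_hom I.M.isComodule
  have hbi := β_inj I.M.isComodule
  obtain ⟨K, hK, hc⟩ := hI (cofree k C I.M.V) I.M.β hhom hbi
  -- retraction
  have hr : ∃ r : I.M.V ⊗[k] C →ₗ[k] I.M.V, IsComodHom (cofreeβ k C I.M.V) I.M.β r ∧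
      r ∘ₗ I.M.β = LinearMap.id := by
    change Submodule k (I.M.V ⊗[k] C) at K
    let e := LinearEquiv.ofInjective I.M.β hbi
    let r : I.M.V ⊗[k] C →ₗ[k] I.M.V :=
      e.symm.toLinearMap ∘ₗ (LinearMap.range I.M.β).projectionOnto K hc
    have hrβ : ∀ v, r (I.M.β v) = v := by
      intro v
      have : (LinearMap.range I.M.β).projectionOnto K hc (I.M.β v) = e v :=
        Submodule.projectionOnto_apply_left hc (e v)
      simp [r, this]
    have hrK : ∀ v ∈ K, r v = 0 := by
      intro v hv
      have : (LinearMap.range I.M.β).projectionOnto K hc v = 0 :=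
        Submodule.projectionOnto_apply_right hc ⟨v, hv⟩
      simp [r, this]
    refine ⟨r, ?_, LinearMap.ext hrβ⟩
    rw [isHom_iff] at hhom ⊢
    intro f v
    have : v ∈ LinearMap.range I.M.β ⊔ K := by
      have := hc.sup_eq_top
      change LinearMap.range I.M.β ⊔ K = ⊤ at this
      rw [this]; trivial
    obtain ⟨_, ⟨x, rfl⟩, y, hy, rfl⟩ := Submodule.mem_sup.1 this
    simp only [map_add]
    rw [← hhom, hrβ, hrβ, hrK y hy, hrK _ ((isSub_iff (cofreeβ k C I.M.V) K).1 hK f y hy), map_zero]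
  obtain ⟨r, hr, hrβ⟩ := hr
  obtain ⟨h, hh, hhe⟩ := cofree_extend X.M.isComodule X.hom X.inj (isHom_comp hhom I.hom)
  have hcomp : (r ∘ₗ h) ∘ₗ X.emb = I.emb := by
    rw [LinearMap.comp_assoc, hhe, ← LinearMap.comp_assoc, hrβ, LinearMap.id_comp]
  have hH := isHom_comp hr hh
  refine ⟨r ∘ₗ h, hH, ?_, hcomp⟩
  rw [← LinearMap.ker_eq_bot]
  by_contra hne
  obtain ⟨S, hS, hSs⟩ := exists_simple X.M.isComodule (isSub_comap hH (isSub_bot _)) hne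
  apply hSs.2.1
  rw [eq_bot_iff]
  intro s hs
  have h1 : s ∈ LinearMap.range X.emb := by
    rw [X.socle_eq]
    exact (le_sSup hSs : S ≤ _) hs
  obtain ⟨v, rfl⟩ := h1
  have h2 : (r ∘ₗ h) (X.emb v) = 0 := hS hs
  rw [← LinearMap.comp_apply, hcomp] at h2
  have : v = 0 := I.inj (by rw [h2, map_zero])
  simp [this]

end hull

/-- For a semisimple comodule `V` over a coalgebra `C`, the following are equivalent:
(1) the family `F_V` of comodules with socle `V` has a greatest element;
(2) every totally ordered subset of `F_V` has an upper bound in `F_V`;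
(3) `F_V` has a maximal element;
(4) there is an `X ∈ F_V` which splits off every comodule containing it.
Moreover any `I ∈ F_V` satisfying (4) receives an embedding from every member of `F_V`
(i.e. every comodule `W` embeds into `I_{σ(W)}`), and conversely this embedding
property implies (1). -/
theorem socleExt_tfae (V : Comod k C) (hV : IsSemisimpleComod V) :
    ((∃ G : SocleExt V, ∀ X : SocleExt V, X.le G) ↔
      (∀ S : Set (SocleExt V), IsChain SocleExt.le S →
        ∃ U : SocleExt V, ∀ X ∈ S, X.le U)) ∧
    ((∀ S : Set (SocleExt V), IsChain SocleExt.le S →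
        ∃ U : SocleExt V, ∀ X ∈ S, X.le U) ↔
      (∃ M : SocleExt V, ∀ X : SocleExt V, M.le X → X.le M)) ∧
    ((∃ M : SocleExt V, ∀ X : SocleExt V, M.le X → X.le M) ↔
      (∃ X : SocleExt V, X.IsInj)) ∧
    (∀ I : SocleExt V, I.IsInj → ∀ X : SocleExt V, X.le I) ∧
    ((∃ I : SocleExt V, I.IsInj ∧ ∀ X : SocleExt V, X.le I) →
      ∃ G : SocleExt V, ∀ X : SocleExt V, X.le G) := by
  obtain ⟨I, hI⟩ := exists_isInj V hV
  have h1 : ∃ G : SocleExt V, ∀ X : SocleExt V, X.le G := ⟨I, le_of_isInj I hI⟩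
  have h2 : ∀ S : Set (SocleExt V), IsChain SocleExt.le S →
        ∃ U : SocleExt V, ∀ X ∈ S, X.le U := fun S _ => ⟨I, fun X _ => le_of_isInj I hI X⟩
  have h3 : ∃ M : SocleExt V, ∀ X : SocleExt V, M.le X → X.le M :=
    ⟨I, fun X _ => le_of_isInj I hI X⟩
  exact ⟨iff_of_true h1 h2, iff_of_true h2 h3, iff_of_true h3 ⟨I, hI⟩, le_of_isInj, fun _ => h1⟩

end SuperCoalg
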